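/- Let r_H(λ, μ) = E(η̂_H(μ+z, λ) − μ)² with z ~ N(0,1), where η̂_H(x,λ) = x·1{|x| > λ}. Then as λ → ∞: (i) r_H(λ, λ) = (1+o(1))·λ²/2; and (ii) r_H(λ, λ − √(2 log λ)) = λ² − (2√2 + o(1))·λ√(log λ). -/

import Mathlib

open MeasureTheory ProbabilityTheory Filter
open scoped ENNReal NNReal Topology

noncomputable section

/-- One-dimensional hard thresholding risk
`r_H(λ, μ) = E(η̂_H(μ+z,λ) − μ)²`, `z ~ N(0,1)`, where `η̂_H(x,λ) = x·1{|x|>λ}`. -/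
def rH (lam μ : ℝ) : ℝ :=
  ∫ z, ((if lam < |μ + z| then μ + z else 0) - μ) ^ 2 ∂(gaussianReal 0 1)

lemma gau_sq_int : Integrable (fun z : ℝ => z ^ 2) (gaussianReal 0 1) := by
  have := (memLp_id_gaussianReal (μ := 0) (v := 1) 2).integrable_sq
  simpa using this

lemma gau_sq : ∫ z, z ^ 2 ∂(gaussianReal 0 1) = 1 := by
  have h := variance_id_gaussianReal (μ := 0) (v := 1)
  rw [variance_eq_integral (by fun_prop)] at h
  simpa using h

lemma gau_ge (a : ℝ) (ha : 0 ≤ a) :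
    (gaussianReal 0 1).real {z | a ≤ z} ≤ Real.exp (-a ^ 2 / 2) := by
  have h := measure_ge_le_exp_mul_mgf (μ := gaussianReal 0 1) (X := id) a ha
    (by simpa using integrable_exp_mul_gaussianReal (μ := 0) (v := 1) a)
  have h2 := congrFun (mgf_id_gaussianReal (μ := 0) (v := 1)) a
  rw [h2, ← Real.exp_add] at h
  refine h.trans (le_of_eq ?_)
  congr 1
  simp
  ring

lemma gau_neg (s : Set ℝ) (hs : MeasurableSet s) :
    (gaussianReal 0 1).real {z | -z ∈ s} = (gaussianReal 0 1).real s := by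
  have h := gaussianReal_map_neg (μ := 0) (v := 1)
  rw [neg_zero] at h
  conv_rhs => rw [← h]
  rw [map_measureReal_apply (by fun_prop) hs]
  rfl

lemma gau_le (a : ℝ) (ha : 0 ≤ a) :
    (gaussianReal 0 1).real {z | z ≤ -a} ≤ Real.exp (-a ^ 2 / 2) := by
  have h := gau_neg {z | a ≤ z} measurableSet_Ici
  refine le_trans (le_of_eq ?_) (gau_ge a ha)
  rw [← h]
  congr 1
  ext z
  simp only [Set.mem_ofPred_eq]
  constructor <;> intro h <;> linarith

lemma gau_half : (gaussianReal 0 1).real {z | 0 < z} = 1 / 2 := by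
  have h := gau_neg {z | 0 < z} measurableSet_Ioi
  have hc := probReal_compl_eq_one_sub (μ := gaussianReal 0 1)
    (s := {z : ℝ | 0 < z}) measurableSet_Ioi
  have : NullSingletonClass (gaussianReal 0 1) := nullSingletonClass_gaussianReal (by simp)
  have h1 : (gaussianReal 0 1).real {z : ℝ | 0 < z}ᶜ
      = (gaussianReal 0 1).real {z | -z ∈ {z : ℝ | 0 < z}} := by
    have e1 : {z : ℝ | 0 < z}ᶜ = Set.Iic 0 := by ext; simp
    have e2 : {z : ℝ | -z ∈ {z : ℝ | 0 < z}} = Set.Iio 0 := by ext; simp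
    rw [e1, e2]
    exact (measureReal_congr Iio_ae_eq_Iic).symm
  linarith

lemma rH_eq (lam μ : ℝ) : ∃ e : ℝ, 0 ≤ e ∧ e ≤ 1 ∧
    rH lam μ = μ ^ 2 - μ ^ 2 * (gaussianReal 0 1).real {z | lam < |μ + z|} + e := by
  set A : Set ℝ := {z | lam < |μ + z|} with hA
  have hAm : MeasurableSet A := measurableSet_lt (by fun_prop) (by fun_prop)
  refine ⟨∫ z in A, z ^ 2 ∂(gaussianReal 0 1), ?_, ?_, ?_⟩
  · exact integral_nonneg fun z => sq_nonneg z
  · rw [← gau_sq]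
    exact setIntegral_le_integral gau_sq_int (Eventually.of_forall fun z => sq_nonneg z)
  · have hc := probReal_compl_eq_one_sub (μ := gaussianReal 0 1) hAm
    have h : rH lam μ = ∫ z, (A.indicator (fun z => z ^ 2) z + Aᶜ.indicator (fun _ => μ ^ 2) z)
        ∂(gaussianReal 0 1) := by
      unfold rH
      congr 1
      ext z
      by_cases hz : z ∈ A
      · have hz' : lam < |μ + z| := hz
        simp [hz, hz']
      · have hz' : ¬ lam < |μ + z| := hz
        simp only [hz', if_false]
        simp [hz]
    rw [h, integral_add (gau_sq_int.indicator hAm) ((integrable_const _).indicator hAm.compl),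
      integral_indicator hAm, integral_indicator hAm.compl, setIntegral_const, hc]
    simp only [smul_eq_mul]
    ring

/-- Lemma `lem::hard-threshold-risk-near-lambda`: as `λ → ∞`,
`r_H(λ,λ) = (1+o(1))·λ²/2` and `r_H(λ, λ−√(2 log λ)) = λ² − (2√2+o(1))·λ√(log λ)`. -/
theorem statement18 :
    Tendsto (fun lam : ℝ => rH lam lam / (lam ^ 2 / 2)) atTop (𝓝 1) ∧
    Tendsto
      (fun lam : ℝ =>
        (rH lam (lam - Real.sqrt (2 * Real.log lam)) - lam ^ 2) /
          (lam * Real.sqrt (Real.log lam)))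
      atTop (𝓝 (-(2 * Real.sqrt 2))) := by
  constructor
  · have hexp : Tendsto (fun lam : ℝ => Real.exp (-lam)) atTop (𝓝 0) :=
      Real.tendsto_exp_neg_atTop_nhds_zero
    have hinv : Tendsto (fun lam : ℝ => (lam ^ 2)⁻¹) atTop (𝓝 0) :=
      tendsto_inv_atTop_zero.comp (tendsto_pow_atTop (by norm_num))
    have hlo : Tendsto (fun lam : ℝ => 1 - 2 * Real.exp (-lam)) atTop (𝓝 1) := by
      simpa using (hexp.const_mul 2).const_sub 1
    have hup : Tendsto (fun lam : ℝ => 1 + 2 * (lam ^ 2)⁻¹) atTop (𝓝 1) := by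
      simpa using (hinv.const_mul 2).const_add 1
    have key : ∀ lam : ℝ, 1 ≤ lam → 1 - 2 * Real.exp (-lam) ≤ rH lam lam / (lam ^ 2 / 2) ∧
        rH lam lam / (lam ^ 2 / 2) ≤ 1 + 2 * (lam ^ 2)⁻¹ := by
      intro lam hl
      obtain ⟨e, he0, he1, he⟩ := rH_eq lam lam
      have hp1 : 1 / 2 ≤ (gaussianReal 0 1).real {z | lam < |lam + z|} := by
        rw [← gau_half]
        refine measureReal_mono ?_
        intro z hz
        have hz' : 0 < z := hz
        have := le_abs_self (lam + z)
        show lam < |lam + z|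
        linarith
      have hp2 : (gaussianReal 0 1).real {z | lam < |lam + z|} ≤ 1 / 2 + Real.exp (-lam) := by
        have h1 : (gaussianReal 0 1).real {z | lam < |lam + z|} ≤
            (gaussianReal 0 1).real ({z | 0 < z} ∪ {z | z ≤ -(2 * lam)}) := by
          refine measureReal_mono ?_
          intro z hz
          have hz' : lam < |lam + z| := hz
          rcases lt_abs.1 hz' with h | h
          · left; show 0 < z; linarith
          · right; show z ≤ -(2 * lam); linarith
        have h2 := measureReal_union_le (μ := gaussianReal 0 1) {z : ℝ | 0 < z} {z | z ≤ -(2 * lam)}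
        have h3 := gau_le (2 * lam) (by linarith)
        have h4 : Real.exp (-(2 * lam) ^ 2 / 2) ≤ Real.exp (-lam) :=
          Real.exp_le_exp.2 (by nlinarith)
        rw [gau_half] at h2
        linarith
      set p := (gaussianReal 0 1).real {z | lam < |lam + z|}
      have hpos : 0 < lam ^ 2 := by positivity
      have hq : rH lam lam / (lam ^ 2 / 2) = 2 - 2 * p + 2 * e * (lam ^ 2)⁻¹ := by
        rw [he]; field_simp
      have hi : 0 < (lam ^ 2)⁻¹ := by positivity
      rw [hq]
      constructor <;> nlinarith
    refine tendsto_of_tendsto_of_tendsto_of_le_of_le' hlo hup ?_ ?_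
    · filter_upwards [eventually_ge_atTop 1] with lam hl using (key lam hl).1
    · filter_upwards [eventually_ge_atTop 1] with lam hl using (key lam hl).2
  · -- second part
    have hs : Tendsto (fun lam : ℝ => Real.sqrt (Real.log lam)) atTop atTop :=
      Real.tendsto_sqrt_atTop.comp Real.tendsto_log_atTop
    have hsi : Tendsto (fun lam : ℝ => 2 * (Real.sqrt (Real.log lam))⁻¹) atTop (𝓝 0) := by
      simpa using (tendsto_inv_atTop_zero.comp hs).const_mul 2
    have hlog : Tendsto (fun lam : ℝ => Real.log lam / lam) atTop (𝓝 0) :=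
      Real.isLittleO_log_id_atTop.tendsto_div_nhds_zero
    have hlo : Tendsto (fun lam : ℝ => -(2 * Real.sqrt 2) - 2 * (Real.sqrt (Real.log lam))⁻¹)
        atTop (𝓝 (-(2 * Real.sqrt 2))) := by
      simpa using hsi.const_sub (-(2 * Real.sqrt 2))
    have hup : Tendsto (fun lam : ℝ => -(2 * Real.sqrt 2) + (2 * (Real.log lam / lam) + lam⁻¹))
        atTop (𝓝 (-(2 * Real.sqrt 2))) := by
      simpa using ((hlog.const_mul 2).add tendsto_inv_atTop_zero).const_add (-(2 * Real.sqrt 2))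
    have key : ∀ᶠ lam : ℝ in atTop,
        -(2 * Real.sqrt 2) - 2 * (Real.sqrt (Real.log lam))⁻¹ ≤
          (rH lam (lam - Real.sqrt (2 * Real.log lam)) - lam ^ 2) /
          (lam * Real.sqrt (Real.log lam)) ∧
        (rH lam (lam - Real.sqrt (2 * Real.log lam)) - lam ^ 2) /
          (lam * Real.sqrt (Real.log lam)) ≤
          -(2 * Real.sqrt 2) + (2 * (Real.log lam / lam) + lam⁻¹) := by
      filter_upwards [eventually_ge_atTop 2, hs.eventually_ge_atTop 1,
        hlog.eventually_le_const (show (0 : ℝ) < 1 / 2 by norm_num)] with lam hl hs1 hl2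
      have hl0 : 0 < lam := by linarith
      have hL : 0 ≤ Real.log lam := Real.log_nonneg (by linarith)
      rw [div_le_iff₀ hl0] at hl2
      set s := Real.sqrt (Real.log lam) with hsdef
      have hss : s ^ 2 = Real.log lam := Real.sq_sqrt hL
      have hr2 : Real.sqrt 2 ^ 2 = 2 := Real.sq_sqrt (by norm_num)
      have hr0 : 0 ≤ Real.sqrt 2 := Real.sqrt_nonneg 2
      have ha : Real.sqrt (2 * Real.log lam) = Real.sqrt 2 * s := Real.sqrt_mul (by norm_num) _
      rw [ha]
      set a := Real.sqrt 2 * s with hadef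
      have ha2 : a ^ 2 = 2 * s ^ 2 := by rw [hadef, mul_pow, hr2]
      have ha0 : 0 ≤ a := by positivity
      have hal : a ≤ lam := by nlinarith
      obtain ⟨e, he0, he1, he⟩ := rH_eq lam (lam - a)
      have hexp : Real.exp (-a ^ 2 / 2) = lam⁻¹ := by
        have : -a ^ 2 / 2 = - Real.log lam := by rw [← hss]; linarith
        rw [this, Real.exp_neg, Real.exp_log hl0]
      have hp0 : 0 ≤ (gaussianReal 0 1).real {z | lam < |lam - a + z|} := measureReal_nonneg
      have hp1 : (gaussianReal 0 1).real {z | lam < |lam - a + z|} ≤ 2 * lam⁻¹ := by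
        have h1 : (gaussianReal 0 1).real {z | lam < |lam - a + z|} ≤
            (gaussianReal 0 1).real ({z | a ≤ z} ∪ {z | z ≤ -a}) := by
          refine measureReal_mono ?_
          intro z hz
          have hz' : lam < |lam - a + z| := hz
          rcases lt_abs.1 hz' with h | h
          · left; show a ≤ z; linarith
          · right; show z ≤ -a; linarith
        have h2 := measureReal_union_le (μ := gaussianReal 0 1) {z : ℝ | a ≤ z} {z | z ≤ -a}
        have h3 := gau_le a ha0
        have h4 := gau_ge a ha0
        rw [hexp] at h3 h4
        linarith
      set p := (gaussianReal 0 1).real {z | lam < |lam - a + z|}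
      have hs0 : 0 < s := by linarith
      have hm1 : 0 ≤ (lam - a) ^ 2 * p := by positivity
      have hm2 : (lam - a) ^ 2 * p ≤ 2 * lam := by
        calc (lam - a) ^ 2 * p ≤ lam ^ 2 * (2 * lam⁻¹) := by
              apply mul_le_mul _ hp1 hp0 (by positivity)
              exact pow_le_pow_left₀ (by linarith) (by linarith) 2
          _ = 2 * lam := by field_simp
      rw [he, ← hss]
      constructor
      · rw [le_div_iff₀ (by positivity)]
        have : (-(2 * Real.sqrt 2) - 2 * s⁻¹) * (lam * s) = -2 * lam * a - 2 * lam := by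
          rw [hadef]; field_simp
        rw [this]
        nlinarith [sq_nonneg a]
      · rw [div_le_iff₀ (by positivity)]
        have : (-(2 * Real.sqrt 2) + (2 * (s ^ 2 / lam) + lam⁻¹)) * (lam * s)
            = -2 * lam * a + (2 * s ^ 2 + 1) * s := by
          rw [hadef]; field_simp
        rw [this]
        nlinarith [sq_nonneg a, sq_nonneg s]
    exact tendsto_of_tendsto_of_tendsto_of_le_of_le' hlo hup
      (key.mono fun _ h => h.1) (key.mono fun _ h => h.2)
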